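/- arXiv:1703.04950 — 2 statements merged into one kernel-verified Lean document; each statement's English description precedes it below -/
import Mathlib

section
/- The Thue equation x^5 + 65·x^4·y − 870·x^3·y^2 − 18990·x^2·y^3 + 26325·x·y^4 + 255069·y^5 = −2^5·3^4 has no integer solutions (x, y). -/
open NumberTheorySymbols

/-- The Jacobi symbol of `a` is `1` modulo any `n` for which `a * v ^ 2` is a square. -/
theorem jacobiSym_eq_one_of_dvd_sq_sub {n v : ℕ} {a z : ℤ} (h : (n : ℤ) ∣ z ^ 2 - a * v ^ 2)
    (ha : a.gcd n = 1) (hv : v.Coprime n) : J(a | n) = 1 := by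
  have hmod : J(z ^ 2 | n) = J(a * v ^ 2 | n) :=
    jacobiSym.mod_left' (Int.ModEq.symm (Int.modEq_iff_dvd.2 h))
  have hv1 : J((v : ℤ) ^ 2 | n) = 1 := jacobiSym.sq_one' (by simpa using hv)
  rw [jacobiSym.mul_left, hv1, mul_one, jacobiSym.pow_left] at hmod
  rcases jacobiSym.eq_one_or_neg_one ha with h1 | h1
  · exact h1
  · nlinarith [sq_nonneg J(z | n)]

theorem jacobiSym_neg_thirty_of_dvd {L v : ℕ} {z : ℤ} (h : (L : ℤ) ∣ z ^ 2 + 30 * v ^ 2)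
    (hv : v.Coprime L) (hL : Nat.Coprime 30 L) : J(-30 | L) = 1 :=
  jacobiSym_eq_one_of_dvd_sq_sub (z := z) (v := v) (by convert h using 1; ring)
    (by simpa [Int.gcd] using hL) hv

theorem jacobiSym_neg_twentyTwo {R : ℕ} (h8 : R % 8 = 3 ∨ R % 8 = 5)
    (h11 : R % 11 = 2 ∨ R % 11 = 6 ∨ R % 11 = 7 ∨ R % 11 = 8 ∨ R % 11 = 10) :
    J(-22 | R) = 1 := by
  have hmod := jacobiSym.mod_right (-22) (b := R) (Nat.odd_iff.2 (by omega))
  have hr : R % 88 = 35 ∨ R % 88 = 83 ∨ R % 88 = 51 ∨ R % 88 = 19 ∨ R % 88 = 43 ∨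
      R % 88 = 13 ∨ R % 88 = 61 ∨ R % 88 = 29 ∨ R % 88 = 85 ∨ R % 88 = 21 := by omega
  norm_num at hmod
  rw [hmod]
  rcases hr with h | h | h | h | h | h | h | h | h | h <;> rw [h] <;> norm_num

theorem jacobiSym_modulus_nineteen {G R v w : ℕ} {z : ℤ} (hG : G ≠ 0)
    (h1 : (G : ℤ) ∣ z ^ 2 - 19 * R * v ^ 2) (hv : v.Coprime G)
    (h2 : (R : ℤ) ∣ 61 ^ 2 * G + 22 * (8 * w) ^ 2) (hw : w.Coprime R)
    (h8 : R % 8 = 3 ∨ R % 8 = 5 ∧ G % 8 = 2)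
    (h11 : R % 11 = 2 ∨ R % 11 = 6 ∨ R % 11 = 7 ∨ R % 11 = 8 ∨ R % 11 = 10)
    (h19 : ¬ 19 ∣ G) : J(G | 19) = 1 := by
  have hRodd : Odd R := Nat.odd_iff.2 (by omega)
  have : NeZero R := ⟨by omega⟩
  have h8w : Nat.Coprime (8 * w) R :=
    Nat.Coprime.mul_left ((Nat.coprime_two_left.2 hRodd).pow_left 3) hw
  have hGR : J(G | R) = 1 := by
    have hmod : J((61 : ℤ) ^ 2 * G | R) = J(-22 * ((8 * w : ℕ) : ℤ) ^ 2 | R) :=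
      jacobiSym.mod_left' (Int.ModEq.symm (Int.modEq_iff_dvd.2
        (by convert h2 using 1; push_cast; ring)))
    rw [jacobiSym.mul_left, jacobiSym.mul_left,
      jacobiSym.sq_one' (a := ((8 * w : ℕ) : ℤ)) (by simpa only [Int.gcd_natCast_natCast] using h8w),
      jacobiSym_neg_twentyTwo (by omega) h11, jacobiSym.pow_left] at hmod
    rcases jacobiSym.trichotomy 61 R with h | h | h <;> rw [h] at hmod <;> linarith
  obtain ⟨k, g, hg, rfl⟩ := Nat.exists_eq_two_pow_mul_odd hG
  have hgR : g.Coprime R := by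
    have : (2 ^ k * g).Coprime R := by
      by_contra hc
      have h0 : J((2 ^ k * g : ℕ) | R) = 0 :=
        jacobiSym.eq_zero_iff.2 ⟨NeZero.ne R, by simpa only [Int.gcd_natCast_natCast] using hc⟩
      omega
    exact this.coprime_dvd_left (Dvd.intro_left _ rfl)
  have hg19 : g.Coprime 19 :=
    ((Nat.Prime.coprime_iff_not_dvd (by norm_num)).2 fun h => h19 (h.mul_left _)).symm
  have hsq : J((19 * R : ℕ) | g) = 1 :=
    jacobiSym_eq_one_of_dvd_sq_sub (z := z) (v := v)
      (dvd_trans (Int.natCast_dvd_natCast.2 (Dvd.intro_left _ rfl)) (by push_cast at h1 ⊢; exact h1))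
      (by simpa only [Int.gcd_natCast_natCast] using (hg19.mul_right hgR).symm)
      (hv.coprime_dvd_right (Dvd.intro_left _ rfl))
  have h19R : Odd (19 * R) := Nat.odd_iff.2 (by omega)
  have hflip : J(g | 19 * R) = 1 := by
    rcases h8 with h8 | ⟨h8, h8'⟩
    · rw [← hsq, jacobiSym.quadratic_reciprocity_one_mod_four (by omega) hg]
    · have hk : g % 4 = 1 := by
        have hg2 := Nat.odd_iff.1 hg
        match k, h8' with
        | 0, h8' => omega
        | 1, h8' => omega
        | k + 2, h8' =>
          rw [pow_add, mul_right_comm] at h8'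
          omega
      rw [← hsq, jacobiSym.quadratic_reciprocity_one_mod_four hk h19R]
  have htwo : J(2 | 19 * R) = 1 := by
    have hmod := jacobiSym.mod_right 2 h19R
    norm_num at hmod
    rw [hmod]
    have : 19 * R % 8 = 1 ∨ 19 * R % 8 = 7 := by omega
    rcases this with h | h <;> rw [h] <;> norm_num
  have hprod : J((2 ^ k * g : ℕ) | 19 * R) = 1 := by
    push_cast
    rw [jacobiSym.mul_left, jacobiSym.pow_left, htwo, hflip, one_pow, one_mul]
  rwa [jacobiSym.mul_right, hGR, mul_one] at hprod

theorem jacobiSym_thirtyEight {R : ℕ} (h8 : R % 8 = 1 ∨ R % 8 = 7) :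
    J(38 | R) = J(19 | R) := by
  have hR : Odd R := Nat.odd_iff.2 (by omega)
  have hmod := jacobiSym.mod_right 2 hR
  norm_num at hmod
  rw [show (38 : ℤ) = 2 * 19 by norm_num, jacobiSym.mul_left, hmod]
  rcases h8 with h | h <;> rw [h] <;> norm_num

theorem jacobiSym_remainder_nineteen {G R v w : ℕ} {z : ℤ} (hG : Odd G)
    (h1 : (G : ℤ) ∣ z ^ 2 - R * v ^ 2) (hv : v.Coprime G)
    (h2 : (R : ℤ) ∣ 1049 ^ 2 * G - 38 * (4 * w) ^ 2) (hw : w.Coprime R)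
    (h8 : R % 8 = 1 ∨ R % 8 = 7 ∧ G % 4 = 3) (h19 : ¬ 19 ∣ R) : J(R | 19) = 1 := by
  have hRodd : Odd R := Nat.odd_iff.2 (by omega)
  have : NeZero R := ⟨by omega⟩
  have h4w : Nat.Coprime (4 * w) R :=
    Nat.Coprime.mul_left ((Nat.coprime_two_left.2 hRodd).pow_left 2) hw
  have h19R : J(19 | R) ≠ 0 :=
    jacobiSym.ne_zero (by
      simpa [Int.gcd] using (Nat.Prime.coprime_iff_not_dvd (by norm_num : Nat.Prime 19)).2 h19)
  have hGR : J(G | R) = J(19 | R) := by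
    have hmod : J((1049 : ℤ) ^ 2 * G | R) = J(38 * ((4 * w : ℕ) : ℤ) ^ 2 | R) :=
      jacobiSym.mod_left' (Int.ModEq.symm (Int.modEq_iff_dvd.2
        (by convert h2 using 1; push_cast; ring)))
    rw [jacobiSym.mul_left, jacobiSym.mul_left,
      jacobiSym.sq_one' (a := ((4 * w : ℕ) : ℤ)) (by simpa only [Int.gcd_natCast_natCast] using h4w),
      jacobiSym_thirtyEight (by omega), jacobiSym.pow_left] at hmod
    rcases jacobiSym.trichotomy 1049 R with h | h | h <;> rw [h] at hmod
    · exact absurd (by linarith) h19R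
    all_goals linarith
  have hcop : (R : ℤ).gcd G = 1 := by
    by_contra hc
    refine h19R (hGR ▸ jacobiSym.eq_zero_iff.2 ⟨NeZero.ne R, ?_⟩)
    rwa [Int.gcd_comm]
  have hsq : J(R | G) = 1 := jacobiSym_eq_one_of_dvd_sq_sub h1 hcop hv
  rcases h8 with h8 | ⟨h8, h8'⟩
  · rw [jacobiSym.quadratic_reciprocity_one_mod_four (by omega) hG, hGR] at hsq
    rw [← hsq]
    exact jacobiSym.quadratic_reciprocity_one_mod_four (a := R) (b := 19) (by omega) (by decide)
  · rw [jacobiSym.quadratic_reciprocity_three_mod_four (by omega) h8', hGR] at hsq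
    rw [← hsq]
    exact jacobiSym.quadratic_reciprocity_three_mod_four (a := R) (b := 19) (by omega) (by decide)

theorem three_coprime {n : ℕ} (h : n % 3 ≠ 0) : Nat.Coprime 3 n :=
  (Nat.Prime.coprime_iff_not_dvd Nat.prime_three).2 (by omega)

theorem thirty_coprime {n : ℕ} (h2 : n % 2 ≠ 0) (h3 : n % 3 ≠ 0) (h5 : n % 5 ≠ 0) :
    Nat.Coprime 30 n := by
  have h2' : Nat.Coprime 2 n := (Nat.Prime.coprime_iff_not_dvd Nat.prime_two).2 (by omega)
  have h5' : Nat.Coprime 5 n := (Nat.Prime.coprime_iff_not_dvd Nat.prime_five).2 (by omega)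
  exact (h2'.mul_left (three_coprime h3)).mul_left h5'

section Integral

variable {M Y : ℤ}

theorem integral_emod_eight (h : Y ^ 2 = M ^ 5 - 55) (hM : 4 ≤ M) (h2 : M % 2 = 0)
    (h5 : M % 5 = 1) : M % 8 = 0 ∨ M % 8 = 6 := by
  obtain ⟨L, hL⟩ := Int.eq_ofNat_of_zero_le (a := 3 * M - 5) (by omega)
  have h30 : Nat.Coprime 30 L := thirty_coprime (by omega) (by omega) (by omega)
  have h32 : Nat.Coprime 32 L :=
    (h30.coprime_dvd_left (by norm_num : 2 ∣ 30)).pow_left 5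
  have hJ := jacobiSym_neg_thirty_of_dvd (L := L) (v := 32) (z := 27 * Y)
    (by
      rw [← hL]
      refine ⟨3 * ((3 * M) ^ 4 + 5 * (3 * M) ^ 3 + 25 * (3 * M) ^ 2 + 125 * (3 * M) + 625), ?_⟩
      push_cast
      linear_combination 729 * h) h32 h30
  have hmod := jacobiSym.mod_right (-30) (b := L) (Nat.odd_iff.2 (by omega))
  norm_num at hmod
  rw [hJ] at hmod
  by_contra hc
  have hM8 : M % 8 = 2 ∨ M % 8 = 4 := by omega
  have hL8 : L % 8 = 1 ∨ L % 8 = 7 := by omega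
  have hL15 : L % 15 = 13 := by omega
  have hr : L % 120 = 73 ∨ L % 120 = 103 := by omega
  rcases hr with hr | hr <;> rw [hr] at hmod <;> norm_num at hmod

theorem emod_nine_of_sq_eq (h : Y ^ 2 = M ^ 5 - 55) (h3 : M % 3 = 1) : M % 9 = 1 ∧ 3 ∣ Y := by
  have hY : Y * Y % 9 = (M ^ 5 - 55) % 9 := by rw [← h, pow_two]
  have hM9 : M % 9 = 1 ∨ M % 9 = 4 ∨ M % 9 = 7 := by omega
  have hY9 : Y % 9 = 0 ∨ Y % 9 = 1 ∨ Y % 9 = 2 ∨ Y % 9 = 3 ∨ Y % 9 = 4 ∨ Y % 9 = 5 ∨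
    Y % 9 = 6 ∨ Y % 9 = 7 ∨ Y % 9 = 8 := by omega
  clear h
  rcases hM9 with hm | hm | hm <;>
    rcases hY9 with hy | hy | hy | hy | hy | hy | hy | hy | hy <;>
    first
    | (exfalso; simp [pow_succ, Int.sub_emod, Int.mul_emod, hm, hy] at hY; done)
    | omega

/-- Dividing `M ^ 2 + 3 * M - 22` and `61 * M - 187` by `9` when both are multiples of `3`. -/
theorem integral_exists_reduced (h : Y ^ 2 = M ^ 5 - 55) (hM : 4 ≤ M) :
    ∃ g r w : ℕ, ∃ z : ℤ,
      ((g : ℤ) = M ^ 2 + 3 * M - 22 ∧ (r : ℤ) = 61 * M - 187 ∨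
        9 * (g : ℤ) = M ^ 2 + 3 * M - 22 ∧ 9 * (r : ℤ) = 61 * M - 187) ∧
      (g : ℤ) ∣ z ^ 2 - 19 * r ∧ (r : ℤ) ∣ 61 ^ 2 * g + 22 * (8 * w) ^ 2 ∧ w.Coprime r := by
  have hmul : Y ^ 2 - 19 * (61 * M - 187) =
      (M ^ 2 + 3 * M - 22) * (M ^ 3 - 3 * M ^ 2 + 31 * M - 159) := by linear_combination h
  by_cases h3 : M % 3 = 1
  · obtain ⟨h9, Z, rfl⟩ := emod_nine_of_sq_eq h h3
    obtain ⟨k, rfl⟩ : ∃ k, M = 9 * k + 1 := ⟨M / 9, by omega⟩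
    obtain ⟨g, hg⟩ := Int.eq_ofNat_of_zero_le (a := 9 * k ^ 2 + 5 * k - 2) (by nlinarith)
    obtain ⟨r, hr⟩ := Int.eq_ofNat_of_zero_le (a := 61 * k - 14) (by omega)
    refine ⟨g, r, 1, Z, .inr ⟨by rw [← hg]; ring, by rw [← hr]; ring⟩, ?_, ?_, by simp⟩
    · rw [← hg, ← hr]
      exact ⟨(9 * k + 1) ^ 3 - 3 * (9 * k + 1) ^ 2 + 31 * (9 * k + 1) - 159, by linarith⟩
    · rw [← hg, ← hr]
      exact ⟨61 * (9 * k + 1) + 370, by push_cast; ring⟩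
  · obtain ⟨G, hG⟩ := Int.eq_ofNat_of_zero_le (a := M ^ 2 + 3 * M - 22) (by nlinarith)
    obtain ⟨R, hR⟩ := Int.eq_ofNat_of_zero_le (a := 61 * M - 187) (by omega)
    refine ⟨G, R, 3, Y, .inl ⟨hG.symm, hR.symm⟩, ?_, ?_, three_coprime (by omega)⟩
    · rw [← hG, ← hR]
      exact ⟨_, hmul⟩
    · rw [← hG, ← hR]
      exact ⟨61 * M + 370, by push_cast; ring⟩

theorem integral_emod_nineteen (h : Y ^ 2 = M ^ 5 - 55) (hM : 4 ≤ M)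
    (h8 : M % 8 = 0 ∨ M % 8 = 6)
    (h11 : M % 11 = 1 ∨ M % 11 = 3 ∨ M % 11 = 4 ∨ M % 11 = 5 ∨ M % 11 = 9) :
    ¬ (M % 19 = 6 ∨ M % 19 = 10 ∨ M % 19 = 13) := by
  intro hc
  obtain ⟨g, r, w, z, hgr, hg, hr, hw⟩ := integral_exists_reduced h hM
  have hGM : (M ^ 2 + 3 * M - 22) % 19 = 13 ∨ (M ^ 2 + 3 * M - 22) % 19 = 15 := by
    rcases hc with h | h | h <;> simp [pow_two, Int.sub_emod, Int.add_emod, Int.mul_emod, h]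
  have hG8 : M % 8 = 0 → (M ^ 2 + 3 * M - 22) % 8 = 2 := fun h => by
    simp [pow_two, Int.sub_emod, Int.add_emod, Int.mul_emod, h]
  have hr8 : r % 8 = 3 ∨ r % 8 = 5 ∧ g % 8 = 2 := by
    rcases h8 with h8 | h8
    · have := hG8 h8
      clear h h11 hc hg hr hGM
      omega
    · clear h h11 hc hg hr hGM hG8
      omega
  have hr11 : r % 11 = 2 ∨ r % 11 = 6 ∨ r % 11 = 7 ∨ r % 11 = 8 ∨ r % 11 = 10 := by
    clear h h8 hc hg hr hGM hG8 hr8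
    omega
  have hg19 : g % 19 = 12 ∨ g % 19 = 8 ∨ g % 19 = 13 ∨ g % 19 = 15 := by
    clear h h8 h11 hc hg hr hG8 hr8 hr11
    omega
  have hJ := jacobiSym_modulus_nineteen (v := 1) (by omega) (by simpa using hg) (by simp) hr hw
    hr8 hr11 (by omega)
  rw [jacobiSym.mod_left] at hJ
  norm_cast at hJ
  rcases hg19 with h | h | h | h <;> rw [h] at hJ <;> norm_num at hJ

end Integral

theorem thirteen_coprime {n : ℕ} (h : n % 13 ≠ 0) : Nat.Coprime 13 n :=
  (Nat.Prime.coprime_iff_not_dvd (by norm_num)).2 (by omega)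

/-- If `13` divides the square `N ^ 5 - a`, then so does `169`. -/
theorem emod_of_thirteen_dvd {a N Y : ℤ} (h : Y ^ 2 = N ^ 5 - a) (ha : (N ^ 5 - a) % 13 = 0) :
    (N ^ 5 - a) % 169 = 0 ∧ 13 ∣ Y := by
  have hY : (13 : ℤ) ∣ Y :=
    (Int.prime_iff_natAbs_prime.2 (by norm_num)).dvd_of_dvd_pow (h ▸ Int.dvd_of_emod_eq_zero ha)
  refine ⟨?_, hY⟩
  rw [← h]
  exact Int.emod_eq_zero_of_dvd (pow_dvd_pow_of_dvd hY 2)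

section Integral

variable {M Y : ℤ}

theorem integral_emod_of_emod_thirteen (h : Y ^ 2 = M ^ 5 - 55) (h13 : M % 13 = 9) :
    M % 169 = 35 ∧ 13 ∣ Y := by
  obtain ⟨h169, hY⟩ := emod_of_thirteen_dvd h (by
    simp [pow_succ, Int.sub_emod, Int.mul_emod, h13])
  refine ⟨?_, hY⟩
  obtain ⟨m, rfl⟩ : ∃ m, M = 13 * m + 9 := ⟨M / 13, by omega⟩
  have : ((13 * m + 9) ^ 5 - 55) = 169 * (2197 * m ^ 5 + 7605 * m ^ 4 + 10530 * m ^ 3 +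
    7290 * m ^ 2) + 426465 * m + 58994 := by ring
  omega

theorem integral_exists_reduced_thirteen (h : Y ^ 2 = M ^ 5 - 55) (hM : 4 ≤ M) :
    ∃ g r w : ℕ, ∃ z : ℤ,
      ((g : ℤ) = M ^ 2 + 4 * M - 13 ∧ (r : ℤ) = 1049 * M - 2239 ∨
        169 * (g : ℤ) = M ^ 2 + 4 * M - 13 ∧ 169 * (r : ℤ) = 1049 * M - 2239) ∧
      (g : ℤ) ∣ z ^ 2 - r ∧ (r : ℤ) ∣ 1049 ^ 2 * g - 38 * (4 * w) ^ 2 ∧ w.Coprime r := by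
  have hmul : Y ^ 2 - (1049 * M - 2239) =
      (M ^ 2 + 4 * M - 13) * (M ^ 3 - 4 * M ^ 2 + 29 * M - 168) := by linear_combination h
  by_cases h13 : M % 13 = 9
  · obtain ⟨h9, Z, rfl⟩ := integral_emod_of_emod_thirteen h h13
    obtain ⟨k, rfl⟩ : ∃ k, M = 169 * k + 35 := ⟨M / 169, by omega⟩
    obtain ⟨g, hg⟩ := Int.eq_ofNat_of_zero_le (a := 169 * k ^ 2 + 74 * k + 8) (by nlinarith)
    obtain ⟨r, hr⟩ := Int.eq_ofNat_of_zero_le (a := 1049 * k + 204) (by omega)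
    refine ⟨g, r, 1, Z, .inr ⟨by rw [← hg]; ring, by rw [← hr]; ring⟩, ?_, ?_, by simp⟩
    · rw [← hg, ← hr]
      exact ⟨(169 * k + 35) ^ 3 - 4 * (169 * k + 35) ^ 2 + 29 * (169 * k + 35) - 168,
        by linarith⟩
    · rw [← hg, ← hr]
      exact ⟨1049 * (169 * k + 35) + 6435, by push_cast; ring⟩
  · obtain ⟨G, hG⟩ := Int.eq_ofNat_of_zero_le (a := M ^ 2 + 4 * M - 13) (by nlinarith)
    obtain ⟨R, hR⟩ := Int.eq_ofNat_of_zero_le (a := 1049 * M - 2239) (by omega)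
    refine ⟨G, R, 13, Y, .inl ⟨hG.symm, hR.symm⟩, ?_, ?_, thirteen_coprime (by omega)⟩
    · rw [← hG, ← hR]
      exact ⟨_, hmul⟩
    · rw [← hG, ← hR]
      exact ⟨1049 * M + 6435, by push_cast; ring⟩

theorem integral_emod_nineteen_ne_sixteen (h : Y ^ 2 = M ^ 5 - 55) (hM : 4 ≤ M)
    (h8 : M % 8 = 0 ∨ M % 8 = 6) : M % 19 ≠ 16 := by
  intro hc
  have hG8 : (M ^ 2 + 4 * M - 13) % 4 = 3 := by
    have : M % 4 = 0 ∨ M % 4 = 2 := by omega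
    rcases this with h | h <;> simp [pow_two, Int.sub_emod, Int.add_emod, Int.mul_emod, h]
  obtain ⟨g, r, w, z, hgr, hg, hr, hw⟩ := integral_exists_reduced_thirteen h hM
  clear h
  have hg4 : g % 4 = 3 := by
    clear hg hr hc h8
    omega
  have hr8 : r % 8 = 1 ∨ r % 8 = 7 := by
    clear hg hr hc hG8 hg4
    omega
  have hr19 : r % 19 = 10 ∨ r % 19 = 14 := by
    clear hg hr h8 hG8 hr8 hg4
    omega
  have h19 : ¬ 19 ∣ r := by
    clear hg hr hgr
    omega
  have hJ := jacobiSym_remainder_nineteen (v := 1) (Nat.odd_iff.2 (by clear hg hr hgr; omega))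
    (by simpa using hg) (by simp) hr hw (hr8.imp_right fun h => ⟨h, hg4⟩) h19
  rw [jacobiSym.mod_left] at hJ
  norm_cast at hJ
  rcases hr19 with h | h <;> rw [h] at hJ <;> norm_num at hJ

/-- `Y ^ 2 = M ^ 5 - 55` has no solution in a suitable set of residue classes of `M`. -/
theorem integral_no_point (h : Y ^ 2 = M ^ 5 - 55) (h2 : M % 2 = 0) (h5 : M % 5 = 1)
    (h11 : M % 11 = 1 ∨ M % 11 = 3 ∨ M % 11 = 4 ∨ M % 11 = 5 ∨ M % 11 = 9)
    (h19 : M % 19 = 6 ∨ M % 19 = 10 ∨ M % 19 = 13 ∨ M % 19 = 16) : False := by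
  have hM : 4 ≤ M := by
    by_contra hc
    have : M ^ 5 ≤ 2 ^ 5 := (Odd.strictMono_pow (by decide)).monotone (by omega)
    nlinarith [sq_nonneg Y]
  have h8 := integral_emod_eight h hM h2 h5
  have := integral_emod_nineteen h hM h8 h11
  have := integral_emod_nineteen_ne_sixteen h hM h8
  tauto

end Integral

section Scaled

variable {N Y : ℤ}

theorem scaled_emod_eight (h : Y ^ 2 = N ^ 5 - 55 * 9 ^ 5) (hN : 21 ≤ N) (h2 : N % 2 = 0)
    (h3 : N % 3 = 1) (h5 : N % 5 = 4) : N % 8 = 0 ∨ N % 8 = 6 := by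
  obtain ⟨L, hL⟩ := Int.eq_ofNat_of_zero_le (a := N - 15) (by omega)
  have h30 : Nat.Coprime 30 L := thirty_coprime (by omega) (by omega) (by omega)
  have h288 : Nat.Coprime 288 L :=
    ((h30.coprime_dvd_left (by norm_num : 2 ∣ 30)).pow_left 5).mul_left
      ((h30.coprime_dvd_left (by norm_num : 3 ∣ 30)).pow_left 2)
  have hJ := jacobiSym_neg_thirty_of_dvd (L := L) (v := 288) (z := Y)
    (by
      rw [← hL]
      refine ⟨N ^ 4 + 15 * N ^ 3 + 225 * N ^ 2 + 3375 * N + 50625, ?_⟩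
      push_cast
      linear_combination h) h288 h30
  have hmod := jacobiSym.mod_right (-30) (b := L) (Nat.odd_iff.2 (by omega))
  norm_num at hmod
  rw [hJ] at hmod
  by_contra hc
  have hN8 : N % 8 = 2 ∨ N % 8 = 4 := by omega
  have hL8 : L % 8 = 3 ∨ L % 8 = 5 := by omega
  have hL15 : L % 15 = 4 := by omega
  have hr : L % 120 = 19 ∨ L % 120 = 109 := by omega
  rcases hr with hr | hr <;> rw [hr] at hmod <;> norm_num at hmod

theorem scaled_emod_nineteen (h : Y ^ 2 = N ^ 5 - 55 * 9 ^ 5) (hN : 32 ≤ N) (h3 : N % 3 = 1)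
    (h8 : N % 8 = 0 ∨ N % 8 = 6)
    (h11 : N % 11 = 1 ∨ N % 11 = 3 ∨ N % 11 = 4 ∨ N % 11 = 5 ∨ N % 11 = 9) :
    ¬ (N % 19 = 3 ∨ N % 19 = 14 ∨ N % 19 = 16) := by
  intro hc
  obtain ⟨g, hg⟩ := Int.eq_ofNat_of_zero_le (a := N ^ 2 + 27 * N - 1782) (by nlinarith)
  obtain ⟨r, hr⟩ := Int.eq_ofNat_of_zero_le (a := 61 * N - 1683) (by omega)
  have hg19 : (g : ℤ) % 19 = 8 ∨ (g : ℤ) % 19 = 18 := by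
    rw [← hg]
    rcases hc with h | h | h <;> simp [pow_two, Int.sub_emod, Int.add_emod, Int.mul_emod, h]
  have hg3 : (g : ℤ) % 3 = 1 := by
    rw [← hg]
    simp [pow_two, Int.sub_emod, Int.add_emod, Int.mul_emod, h3]
  have hg8 : N % 8 = 0 → (g : ℤ) % 8 = 2 := fun h => by
    rw [← hg]
    simp [pow_two, Int.sub_emod, Int.add_emod, Int.mul_emod, h]
  have hmul : (g : ℤ) ∣ Y ^ 2 - 19 * r * (81 : ℕ) ^ 2 := by
    rw [← hg, ← hr]
    exact ⟨N ^ 3 - 27 * N ^ 2 + 2511 * N - 115911, by push_cast; linear_combination h⟩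
  have hres : (r : ℤ) ∣ 61 ^ 2 * g + 22 * (8 * (27 : ℕ)) ^ 2 := by
    rw [← hg, ← hr]
    exact ⟨61 * N + 3330, by push_cast; ring⟩
  clear h hg
  have hr8 : r % 8 = 3 ∨ r % 8 = 5 ∧ g % 8 = 2 := by
    rcases h8 with h8 | h8
    · have := hg8 h8
      omega
    · omega
  have hJ := jacobiSym_modulus_nineteen (by omega) hmul
    ((three_coprime (by omega)).pow_left 4) hres ((three_coprime (by omega)).pow_left 3) hr8
    (by clear hg19 hg3 hg8 hmul hres hc h8 h3 hr8; omega) (by omega)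
  rw [jacobiSym.mod_left] at hJ
  push_cast at hJ
  rcases hg19 with h | h <;> rw [h] at hJ <;> norm_num at hJ

theorem scaled_emod_of_emod_thirteen (h : Y ^ 2 = N ^ 5 - 55 * 9 ^ 5) (h13 : N % 13 = 3) :
    N % 169 = 146 ∧ 13 ∣ Y := by
  obtain ⟨h169, hY⟩ := emod_of_thirteen_dvd h (by
    simp [pow_succ, Int.sub_emod, Int.mul_emod, h13])
  refine ⟨?_, hY⟩
  obtain ⟨m, rfl⟩ : ∃ m, N = 13 * m + 3 := ⟨N / 13, by omega⟩
  have : ((13 * m + 3) ^ 5 - 55 * 9 ^ 5) = 169 * (2197 * m ^ 5 + 2535 * m ^ 4 + 1170 * m ^ 3 +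
    270 * m ^ 2) + 5265 * m + 243 - 55 * 9 ^ 5 := by ring
  omega

theorem scaled_exists_reduced_thirteen (h : Y ^ 2 = N ^ 5 - 55 * 9 ^ 5) (hN : 21 ≤ N)
    (h3 : N % 3 = 1) :
    ∃ g r w : ℕ, ∃ z : ℤ,
      ((g : ℤ) = N ^ 2 + 36 * N - 1053 ∧ (r : ℤ) = 1049 * N - 20151 ∨
        169 * (g : ℤ) = N ^ 2 + 36 * N - 1053 ∧ 169 * (r : ℤ) = 1049 * N - 20151) ∧
      (g : ℤ) ∣ z ^ 2 - r * (81 : ℕ) ^ 2 ∧ (r : ℤ) ∣ 1049 ^ 2 * g - 38 * (4 * w) ^ 2 ∧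
      w.Coprime r := by
  have hmul : Y ^ 2 - (1049 * N - 20151) * (81 : ℕ) ^ 2 =
      (N ^ 2 + 36 * N - 1053) * (N ^ 3 - 36 * N ^ 2 + 2349 * N - 122472) := by
    push_cast
    linear_combination h
  by_cases h13 : N % 13 = 3
  · obtain ⟨h9, Z, rfl⟩ := scaled_emod_of_emod_thirteen h h13
    obtain ⟨k, rfl⟩ : ∃ k, N = 169 * k + 146 := ⟨N / 169, by omega⟩
    obtain ⟨g, hg⟩ := Int.eq_ofNat_of_zero_le (a := 169 * k ^ 2 + 328 * k + 151) (by nlinarith)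
    obtain ⟨r, hr⟩ := Int.eq_ofNat_of_zero_le (a := 1049 * k + 787) (by omega)
    refine ⟨g, r, 9, Z, .inr ⟨by rw [← hg]; ring, by rw [← hr]; ring⟩, ?_, ?_,
      (three_coprime (by omega)).pow_left 2⟩
    · rw [← hg, ← hr]
      exact ⟨(169 * k + 146) ^ 3 - 36 * (169 * k + 146) ^ 2 + 2349 * (169 * k + 146) - 122472,
        by push_cast at hmul ⊢; linarith⟩
    · rw [← hg, ← hr]
      exact ⟨1049 * (169 * k + 146) + 57915, by push_cast; ring⟩
  · obtain ⟨G, hG⟩ := Int.eq_ofNat_of_zero_le (a := N ^ 2 + 36 * N - 1053) (by nlinarith)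
    obtain ⟨R, hR⟩ := Int.eq_ofNat_of_zero_le (a := 1049 * N - 20151) (by omega)
    refine ⟨G, R, 9 * 13, Y, .inl ⟨hG.symm, hR.symm⟩, ?_, ?_,
      ((three_coprime (by omega)).pow_left 2).mul_left (thirteen_coprime (by omega))⟩
    · rw [← hG, ← hR]
      exact ⟨_, hmul⟩
    · rw [← hG, ← hR]
      exact ⟨1049 * N + 57915, by push_cast; ring⟩

theorem scaled_emod_nineteen_ne_eleven (h : Y ^ 2 = N ^ 5 - 55 * 9 ^ 5) (hN : 21 ≤ N)
    (h3 : N % 3 = 1) (h8 : N % 8 = 0 ∨ N % 8 = 6) : N % 19 ≠ 11 := by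
  intro hc
  have hG4 : (N ^ 2 + 36 * N - 1053) % 4 = 3 := by
    have : N % 4 = 0 ∨ N % 4 = 2 := by omega
    rcases this with h | h <;> simp [pow_two, Int.sub_emod, Int.add_emod, Int.mul_emod, h]
  have hG3 : (N ^ 2 + 36 * N - 1053) % 3 = 1 := by
    simp [pow_two, Int.sub_emod, Int.add_emod, Int.mul_emod, h3]
  obtain ⟨g, r, w, z, hgr, hg, hr, hw⟩ := scaled_exists_reduced_thirteen h hN h3
  have hg4 : g % 4 = 3 := by
    rcases hgr with ⟨hG, -⟩ | ⟨hG, -⟩ <;> rw [← hG] at hG4 <;> clear * - hG4 <;> omega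
  have hg3 : g % 3 = 1 := by
    rcases hgr with ⟨hG, -⟩ | ⟨hG, -⟩ <;> rw [← hG] at hG3 <;> clear * - hG3 <;> omega
  have hr8 : r % 8 = 1 ∨ r % 8 = 7 := by
    rcases hgr with ⟨-, hR⟩ | ⟨-, hR⟩ <;> clear * - h8 hR <;> omega
  have hr19 : r % 19 = 14 ∨ r % 19 = 12 := by
    rcases hgr with ⟨-, hR⟩ | ⟨-, hR⟩ <;> clear * - hc hR <;> omega
  have h19 : ¬ 19 ∣ r := by
    clear * - hr19
    omega
  have hJ := jacobiSym_remainder_nineteen (Nat.odd_iff.2 (by clear * - hg4; omega)) hg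
    ((three_coprime (by rw [hg3]; norm_num)).pow_left 4) hr hw
    (hr8.imp_right fun h => ⟨h, hg4⟩) h19
  rw [jacobiSym.mod_left] at hJ
  norm_cast at hJ
  rcases hr19 with h | h <;> rw [h] at hJ <;> norm_num at hJ

/-- `Y ^ 2 = N ^ 5 - 55 * 9 ^ 5` has no solution in a suitable set of residue classes of `N`. -/
theorem scaled_no_point (h : Y ^ 2 = N ^ 5 - 55 * 9 ^ 5) (h2 : N % 2 = 0) (h3 : N % 3 = 1)
    (h5 : N % 5 = 4)
    (h11 : N % 11 = 1 ∨ N % 11 = 3 ∨ N % 11 = 4 ∨ N % 11 = 5 ∨ N % 11 = 9)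
    (h19 : N % 19 = 3 ∨ N % 19 = 11 ∨ N % 19 = 14 ∨ N % 19 = 16) : False := by
  have hN : 21 ≤ N := by
    by_contra hc
    have : N ^ 5 ≤ 20 ^ 5 := (Odd.strictMono_pow (by decide)).monotone (by omega)
    nlinarith [sq_nonneg Y]
  have h8 := scaled_emod_eight h hN h2 h3 h5
  have := scaled_emod_nineteen h (by omega) h3 h8 h11
  have := scaled_emod_nineteen_ne_eleven h hN h3 h8
  tauto

end Scaled

theorem emod_eleven_of_sq_eq {N Y : ℤ} (h : Y ^ 2 = N ^ 5 - 55 * 9 ^ 5) :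
    N % 11 = 1 ∨ N % 11 = 3 ∨ N % 11 = 4 ∨ N % 11 = 5 ∨ N % 11 = 9 := by
  have hN : ¬ (11 : ℤ) ∣ N := fun hN => by
    have hp : Prime (11 : ℤ) := Int.prime_iff_natAbs_prime.2 (by norm_num)
    have hY : (11 : ℤ) ∣ Y := hp.dvd_of_dvd_pow (n := 2)
      (h ▸ dvd_sub (dvd_pow hN (by norm_num)) (by norm_num))
    obtain ⟨n, rfl⟩ := hN
    obtain ⟨y, rfl⟩ := hY
    ring_nf at h
    omega
  have h11 : ∀ n y : ZMod 11, n ≠ 0 → y ^ 2 = n ^ 5 →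
      n = 1 ∨ n = 3 ∨ n = 4 ∨ n = 5 ∨ n = 9 := by decide
  have hz : (Y : ZMod 11) ^ 2 = (N : ZMod 11) ^ 5 := by
    have := congrArg (Int.cast : ℤ → ZMod 11) h
    push_cast at this
    rw [this, show (3247695 : ZMod 11) = 0 from rfl, sub_zero]
  have := h11 N Y (by rwa [Ne, ZMod.intCast_zmod_eq_zero_iff_dvd N 11]) hz
  have key : ∀ c : ℤ, (N : ZMod 11) = (c : ZMod 11) → N % 11 = c % 11 := fun c hc =>
    (ZMod.intCast_eq_intCast_iff N c 11).1 hc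
  rcases this with h | h | h | h | h
  · have := key 1 (by exact_mod_cast h); omega
  · have := key 3 (by exact_mod_cast h); omega
  · have := key 4 (by exact_mod_cast h); omega
  · have := key 5 (by exact_mod_cast h); omega
  · have := key 9 (by exact_mod_cast h); omega

theorem scaled_three_cases {N Y : ℤ} (h : Y ^ 2 = N ^ 5 - 55 * 9 ^ 5) :
    N % 3 = 1 ∨ ∃ M Z : ℤ, N = 9 * M ∧ Z ^ 2 = M ^ 5 - 55 := by
  have hN : N % 3 = 0 ∨ N % 3 = 1 ∨ N % 3 = 2 := by omega
  rcases hN with hN | hN | hN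
  · right
    obtain ⟨n, rfl⟩ := Int.dvd_of_emod_eq_zero hN
    obtain ⟨y, rfl⟩ : (9 : ℤ) ∣ Y := (Int.pow_dvd_pow_iff (n := 2) (by norm_num)).1
      ⟨3 * n ^ 5 - 55 * 3 ^ 6, by rw [h]; ring⟩
    obtain ⟨z, rfl⟩ : (3 : ℤ) ∣ y := Int.prime_three.dvd_of_dvd_pow (n := 2)
      ⟨n ^ 5 - 55 * 3 ^ 5, by linarith⟩
    obtain ⟨M, rfl⟩ : (3 : ℤ) ∣ n := Int.prime_three.dvd_of_dvd_pow (n := 5)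
      ⟨z ^ 2 + 55 * 3 ^ 4, by linarith⟩
    obtain ⟨Z, rfl⟩ : (9 : ℤ) ∣ z := (Int.pow_dvd_pow_iff (n := 2) (by norm_num)).1
      ⟨M ^ 5 - 55, by linarith⟩
    exact ⟨M, Z, by ring, by linarith⟩
  · exact .inl hN
  · exfalso
    have hY : Y * Y % 3 = (N ^ 5 - 55 * 9 ^ 5) % 3 := by rw [← h, pow_two]
    have hY3 : Y % 3 = 0 ∨ Y % 3 = 1 ∨ Y % 3 = 2 := by omega
    rcases hY3 with hy | hy | hy <;> simp [pow_succ, Int.sub_emod, Int.mul_emod, hN, hy] at hY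

theorem no_thue_solutions_1 (x y : ℤ) :
    x ^ 5 + 65 * x ^ 4 * y - 870 * x ^ 3 * y ^ 2 - 18990 * x ^ 2 * y ^ 3 +
      26325 * x * y ^ 4 + 255069 * y ^ 5 ≠ -(2 ^ 5 * 3 ^ 4) := by
  intro h
  set N := x ^ 2 + 3 * x * y + 126 * y ^ 2 with hNdef
  obtain ⟨Y, hY⟩ : ∃ Y : ℤ, Y ^ 2 = N ^ 5 - 55 * 9 ^ 5 := by
    have hP : (23 * x ^ 5 - 1065 * x ^ 4 * y - 35370 * x ^ 3 * y ^ 2 + 162270 * x ^ 2 * y ^ 3 +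
        2471715 * x * y ^ 4 - 561573 * y ^ 5) ^ 2 = 32 ^ 2 * (N ^ 5 - 55 * 9 ^ 5) := by
      have h2 := congrArg (fun t => 55 * (3 * t) ^ 2) h
      rw [hNdef]
      linear_combination -h2
    obtain ⟨Y, hY⟩ := (Int.pow_dvd_pow_iff (n := 2) (by norm_num)).1 (Dvd.intro _ hP.symm)
    exact ⟨Y, by rw [hY] at hP; linarith⟩
  have hz (m : ℕ) : (x : ZMod m) ^ 5 + 65 * (x : ZMod m) ^ 4 * y - 870 * (x : ZMod m) ^ 3 * y ^ 2 -
      18990 * (x : ZMod m) ^ 2 * y ^ 3 + 26325 * (x : ZMod m) * y ^ 4 + 255069 * (y : ZMod m) ^ 5 =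
      -(2 ^ 5 * 3 ^ 4) := by
    have := congrArg (Int.cast : ℤ → ZMod m) h
    push_cast at this
    linear_combination this
  have hNz (m : ℕ) (c : ℤ) (hc : (x : ZMod m) ^ 2 + 3 * x * y + 126 * y ^ 2 = c) :
      N % m = c % m :=
    (ZMod.intCast_eq_intCast_iff N c m).1 (by rw [← hc, hNdef]; push_cast; rfl)
  have h2 : N % 2 = 0 := hNz 2 0 <| by
    have := hz 2
    generalize (x : ZMod 2) = a at *
    generalize (y : ZMod 2) = b at *
    revert a b
    decide
  have h5 : N % 5 = 4 := hNz 5 4 <| by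
    have := hz 5
    generalize (x : ZMod 5) = a at *
    generalize (y : ZMod 5) = b at *
    revert a b
    decide
  have h19 : N % 19 = 3 ∨ N % 19 = 11 ∨ N % 19 = 14 ∨ N % 19 = 16 := by
    have key : ∀ a b : ZMod 19, a ^ 5 + 65 * a ^ 4 * b - 870 * a ^ 3 * b ^ 2 -
        18990 * a ^ 2 * b ^ 3 + 26325 * a * b ^ 4 + 255069 * b ^ 5 = -(2 ^ 5 * 3 ^ 4) →
        a ^ 2 + 3 * a * b + 126 * b ^ 2 = 3 ∨ a ^ 2 + 3 * a * b + 126 * b ^ 2 = 11 ∨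
        a ^ 2 + 3 * a * b + 126 * b ^ 2 = 14 ∨ a ^ 2 + 3 * a * b + 126 * b ^ 2 = 16 := by
      decide +kernel
    rcases key x y (hz 19) with h | h | h | h
    · exact .inl (hNz 19 3 (by rw [h]; norm_num))
    · exact .inr (.inl (hNz 19 11 (by rw [h]; norm_num)))
    · exact .inr (.inr (.inl (hNz 19 14 (by rw [h]; norm_num))))
    · exact .inr (.inr (.inr (hNz 19 16 (by rw [h]; norm_num))))
  have h11 := emod_eleven_of_sq_eq hY
  rcases scaled_three_cases hY with h3 | ⟨M, Z, hM, hZ⟩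
  · exact scaled_no_point hY h2 h3 h5 h11 h19
  · refine integral_no_point hZ ?_ ?_ ?_ ?_ <;> clear_value N
    · clear * - h2 hM
      omega
    · clear * - h5 hM
      omega
    · clear * - h11 hM
      omega
    · clear * - h19 hM
      omega
end

section
/- If x, z, y1 are positive integers with x^2 + 55·z^2 = 2^5·y1^5, gcd(x, 55z) = 1, x ≡ 1 (mod 4), and x − z ≡ 0 (mod 4), then there exist integers u, v such that (1+ρ)(x − z + 2zρ) = (2 − ρ)(u + vρ)^5 in ℤ[ρ], where ρ^2 − ρ + 14 = 0. -/
open NumberField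

theorem leftMulMatrix_add_mul {R S : Type*} [CommRing R] [CommRing S] [Algebra R S]
    (B : Module.Basis (Fin 2) R S) {ρ : S} (h0 : B 0 = 1) (h1 : B 1 = ρ)
    (hρ : ρ ^ 2 - ρ + 14 = 0) (a b : R) :
    Algebra.leftMulMatrix B (algebraMap R S a + algebraMap R S b * ρ) =
      !![a, -14 * b; b, a + b] := by
  have hsq : ρ * ρ = ρ - 14 := by linear_combination hρ
  have e0 : (algebraMap R S a + algebraMap R S b * ρ) * B 0 = a • B 0 + b • B 1 := by
    simp [h0, h1, Algebra.smul_def]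
  have e1 : (algebraMap R S a + algebraMap R S b * ρ) * B 1 =
      (-14 * b) • B 0 + (a + b) • B 1 := by
    simp only [h0, h1, Algebra.smul_def, map_mul, map_add, map_neg, map_ofNat]
    linear_combination (algebraMap R S b) * hsq
  ext i j
  rw [Algebra.leftMulMatrix_eq_repr_mul]
  fin_cases j
  · simp only [Fin.zero_eta, e0]
    fin_cases i <;> simp
  · simp only [Fin.mk_one, e1]
    fin_cases i <;> simp

theorem norm_add_mul {R S : Type*} [CommRing R] [CommRing S] [Algebra R S]
    (B : Module.Basis (Fin 2) R S) {ρ : S} (h0 : B 0 = 1) (h1 : B 1 = ρ)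
    (hρ : ρ ^ 2 - ρ + 14 = 0) (a b : R) :
    Algebra.norm R (algebraMap R S a + algebraMap R S b * ρ) = a ^ 2 + a * b + 14 * b ^ 2 := by
  rw [Algebra.norm_eq_matrix_det B, leftMulMatrix_add_mul B h0 h1 hρ, Matrix.det_fin_two_of]
  ring

theorem trace_add_mul {R S : Type*} [CommRing R] [CommRing S] [Algebra R S]
    (B : Module.Basis (Fin 2) R S) {ρ : S} (h0 : B 0 = 1) (h1 : B 1 = ρ)
    (hρ : ρ ^ 2 - ρ + 14 = 0) (a b : R) :
    Algebra.trace R S (algebraMap R S a + algebraMap R S b * ρ) = 2 * a + b := by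
  rw [Algebra.trace_eq_matrix_trace B, leftMulMatrix_add_mul B h0 h1 hρ, Matrix.trace_fin_two_of]
  ring

theorem discr_eq_neg_fiftyFive {R S : Type*} [CommRing R] [CommRing S] [Algebra R S]
    (B : Module.Basis (Fin 2) R S) {ρ : S} (h0 : B 0 = 1) (h1 : B 1 = ρ)
    (hρ : ρ ^ 2 - ρ + 14 = 0) : Algebra.discr R B = -55 := by
  have t11 : Algebra.trace R S (1 * 1) = 2 := by
    simpa using trace_add_mul B h0 h1 hρ 1 0
  have t1ρ : Algebra.trace R S (1 * ρ) = 1 := by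
    simpa using trace_add_mul B h0 h1 hρ 0 1
  have tρρ : Algebra.trace R S (ρ * ρ) = -27 := by
    have h := trace_add_mul B h0 h1 hρ (-14) 1
    rw [show ρ * ρ = algebraMap R S (-14) + algebraMap R S 1 * ρ by
      simp only [map_neg, map_ofNat, map_one]; linear_combination hρ, h]
    ring
  rw [Algebra.discr_def, Matrix.det_fin_two]
  simp only [Algebra.traceMatrix_apply, Algebra.traceForm_apply, h0, h1, mul_comm ρ 1, t11, t1ρ,
    tρρ]
  ring

theorem exists_int_of_fiftyFive_mul_sq {b : ℚ} {n : ℤ} (h : 55 * b ^ 2 = n) :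
    ∃ k : ℤ, b = k := by
  have hs : (55 * b) ^ 2 = ((55 * n : ℤ) : ℚ) := by push_cast; linear_combination 55 * h
  obtain ⟨m, hm⟩ : ∃ m : ℤ, (m : ℚ) = 55 * b := by
    have hr : Polynomial.aeval (55 * b) (Polynomial.X ^ 2 - Polynomial.C (55 * n)) = 0 := by
      rw [map_sub, map_pow, Polynomial.aeval_X, Polynomial.aeval_C, hs, eq_intCast, sub_self]
    exact isInteger_of_is_root_of_monic (Polynomial.monic_X_pow_sub_C _ two_ne_zero) hr
  have hmn : m ^ 2 = 55 * n := by rw [← hm] at hs; exact_mod_cast hs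
  have h5 : (5 : ℤ) ∣ m :=
    Int.Prime.dvd_pow' (k := 2) (by norm_num) ⟨11 * n, by rw [hmn]; push_cast; ring⟩
  have h11 : (11 : ℤ) ∣ m :=
    Int.Prime.dvd_pow' (k := 2) (by norm_num) ⟨5 * n, by rw [hmn]; push_cast; ring⟩
  obtain ⟨k, hk⟩ : (55 : ℤ) ∣ m := by omega
  refine ⟨k, ?_⟩
  have : (55 : ℚ) * k = 55 * b := by rw [← hm, hk]; push_cast; ring
  linarith

theorem exists_rat_basis {K : Type*} [Field K] [NumberField K]
    (hK : Module.finrank ℚ K = 2) {ρ : K} (hρ : ρ ^ 2 - ρ + 14 = 0) :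
    ∃ B : Module.Basis (Fin 2) ℚ K, B 0 = 1 ∧ B 1 = ρ := by
  have hli : LinearIndependent ℚ ![(1 : K), ρ] := by
    rw [LinearIndependent.pair_iff' one_ne_zero]
    rintro a rfl
    rw [Algebra.smul_def, mul_one] at hρ
    have : (algebraMap ℚ K) (a ^ 2 - a + 14) = 0 := by simpa using hρ
    rw [map_eq_zero] at this
    nlinarith [sq_nonneg (2 * a - 1)]
  refine ⟨basisOfLinearIndependentOfCardEqFinrank hli (by simp [hK]), ?_, ?_⟩ <;> simp

theorem exists_int_basis {K : Type*} [Field K] [NumberField K]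
    (hK : Module.finrank ℚ K = 2) {ρ : 𝓞 K} (hρ : ρ ^ 2 - ρ + 14 = 0) :
    ∃ B : Module.Basis (Fin 2) ℤ (𝓞 K), B 0 = 1 ∧ B 1 = ρ := by
  have hρK : (ρ : K) ^ 2 - ρ + 14 = 0 := by
    simpa only [map_add, map_sub, map_pow, map_ofNat, map_zero] using
      congrArg (algebraMap (𝓞 K) K) hρ
  obtain ⟨B, h0, h1⟩ := exists_rat_basis hK hρK
  have hB : ![(1 : K), ρ] = B := by
    ext i; fin_cases i <;> simp [h0, h1]
  have hli : LinearIndependent ℤ ![(1 : 𝓞 K), ρ] := by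
    have h : LinearIndependent ℤ ![(1 : K), ρ] := by
      rw [hB]
      exact B.linearIndependent.restrict_scalars' ℤ
    refine LinearIndependent.of_comp (Algebra.linearMap (𝓞 K) K |>.restrictScalars ℤ) ?_
    convert h using 1
    ext i; fin_cases i <;> simp
  suffices hsp : ⊤ ≤ Submodule.span ℤ (Set.range ![(1 : 𝓞 K), ρ]) from
    ⟨Module.Basis.mk hli hsp, by simp, by simp⟩
  rintro w -
  have hw : (w : K) = algebraMap ℚ K (B.repr w 0) + algebraMap ℚ K (B.repr w 1) * ρ := by
    conv_lhs => rw [← B.sum_repr w]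
    rw [Fin.sum_univ_two, h0, h1, Algebra.smul_def, Algebra.smul_def, mul_one]
  generalize B.repr w 0 = a at hw
  generalize B.repr w 1 = b at hw
  have hN := Algebra.coe_norm_int w
  have hT := Algebra.coe_trace_int w
  rw [hw, norm_add_mul B h0 h1 hρK] at hN
  rw [hw, trace_add_mul B h0 h1 hρK] at hT
  generalize Algebra.norm ℤ w = N at hN
  generalize Algebra.trace ℤ (𝓞 K) w = T at hT
  obtain ⟨k, rfl⟩ := exists_int_of_fiftyFive_mul_sq (b := b) (n := 4 * N - T ^ 2) (by
    push_cast; rw [hN, hT]; ring)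
  have hNT : 55 * k ^ 2 = 4 * N - T ^ 2 := by
    have : (55 * k ^ 2 : ℚ) = 4 * N - T ^ 2 := by rw [hN, hT]; ring
    exact_mod_cast this
  obtain ⟨l, hl⟩ : (2 : ℤ) ∣ T - k := by
    have : Even (T ^ 2 + 55 * k ^ 2) := ⟨2 * N, by linarith⟩
    rw [← even_iff_two_dvd]
    simp only [Int.even_add, Int.even_mul, Int.even_pow, Int.even_sub] at this ⊢
    have h55 : ¬ Even (55 : ℤ) := by decide
    tauto
  have ha : a = l := by
    have : ((T - k : ℤ) : ℚ) = ((2 * l : ℤ) : ℚ) := by rw [hl]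
    push_cast at this
    linarith
  subst ha
  have : w = l • 1 + k • ρ := by
    apply RingOfIntegers.coe_injective
    simpa [zsmul_eq_mul] using hw
  rw [this]
  exact add_mem (Submodule.smul_mem _ _ (Submodule.subset_span ⟨0, by simp⟩))
    (Submodule.smul_mem _ _ (Submodule.subset_span ⟨1, by simp⟩))

theorem exists_eq_add_mul {S : Type*} [CommRing S] {ρ : S} (B : Module.Basis (Fin 2) ℤ S)
    (h0 : B 0 = 1) (h1 : B 1 = ρ) (w : S) : ∃ a b : ℤ, w = (a : S) + (b : S) * ρ := by
  refine ⟨B.repr w 0, B.repr w 1, ?_⟩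
  conv_lhs => rw [← B.sum_repr w]
  rw [Fin.sum_univ_two, h0, h1, zsmul_eq_mul, zsmul_eq_mul, mul_one]

theorem norm_int_add_mul {S : Type*} [CommRing S] {ρ : S} (B : Module.Basis (Fin 2) ℤ S)
    (h0 : B 0 = 1) (h1 : B 1 = ρ) (hρ : ρ ^ 2 - ρ + 14 = 0) (a b : ℤ) :
    Algebra.norm ℤ ((a : S) + (b : S) * ρ) = a ^ 2 + a * b + 14 * b ^ 2 := by
  simpa using norm_add_mul B h0 h1 hρ a b

theorem eq_one_or_eq_neg_one_of_isUnit {S : Type*} [CommRing S] {ρ : S}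
    (B : Module.Basis (Fin 2) ℤ S)
    (h0 : B 0 = 1) (h1 : B 1 = ρ) (hρ : ρ ^ 2 - ρ + 14 = 0) {w : S} (hw : IsUnit w) :
    w = 1 ∨ w = -1 := by
  obtain ⟨a, b, rfl⟩ := exists_eq_add_mul B h0 h1 w
  have h := hw.map (Algebra.norm ℤ)
  rw [norm_int_add_mul B h0 h1 hρ, Int.isUnit_iff] at h
  have h' : a ^ 2 + a * b + 14 * b ^ 2 = 1 := by
    rcases h with h | h
    · exact h
    · nlinarith [sq_nonneg (2 * a + b), sq_nonneg b]
  have hb : b = 0 := by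
    by_contra hb
    have : 1 ≤ b ^ 2 := by have := sq_pos_of_ne_zero hb; omega
    nlinarith [sq_nonneg (2 * a + b)]
  subst hb
  have : (a - 1) * (a + 1) = 0 := by linarith
  rcases mul_eq_zero.mp this with h | h
  · left; simp [sub_eq_zero.mp h]
  · right; simp [eq_neg_of_add_eq_zero_left h]

/-- The norm form `a ^ 2 + a * b + 14 * b ^ 2` represents none of the fifth powers `2 ^ 5`, `3 ^ 5`,
and represents `4 ^ 5` only at even arguments. -/
theorem norm_form_eq_pow_five {a b : ℤ} {n : ℕ} (hn : n ≤ 4) (hn0 : n ≠ 0)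
    (h : a ^ 2 + a * b + 14 * b ^ 2 = (n : ℤ) ^ 5) : n = 1 ∨ n = 4 ∧ Even a ∧ Even b := by
  have hs : (2 * a + b) ^ 2 + 55 * b ^ 2 = 4 * (n : ℤ) ^ 5 := by linear_combination 4 * h
  have hn5 : (n : ℤ) ^ 5 ≤ 4 ^ 5 := by gcongr; exact_mod_cast hn
  have hb : b ≤ 8 := by nlinarith [sq_nonneg (2 * a + b)]
  have hb' : -8 ≤ b := by nlinarith [sq_nonneg (2 * a + b)]
  have hs1 : 2 * a + b ≤ 64 := by nlinarith [sq_nonneg b]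
  have hs2 : -64 ≤ 2 * a + b := by nlinarith [sq_nonneg b]
  have ha1 : a ≤ 36 := by omega
  have ha2 : -36 ≤ a := by omega
  clear hs hn5 hs1 hs2
  have key : ∀ n ∈ Finset.Icc (2 : ℕ) 4, ∀ b ∈ Finset.Icc (-8 : ℤ) 8,
      ∀ a ∈ Finset.Icc (-36 : ℤ) 36, a ^ 2 + a * b + 14 * b ^ 2 = (n : ℤ) ^ 5 →
        n = 4 ∧ Even a ∧ Even b := by
    decide +kernel
  rcases Nat.lt_or_ge n 2 with h2 | h2
  · left; omega
  · right
    exact key n (Finset.mem_Icc.mpr ⟨h2, hn⟩) b (Finset.mem_Icc.mpr ⟨hb', hb⟩) a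
      (Finset.mem_Icc.mpr ⟨ha2, ha1⟩) h

/-- In `ℤ[ρ] / 2 ≅ 𝔽₂ × 𝔽₂` every element equals its fifth power. -/
theorem two_dvd_of_two_dvd_pow_five {S : Type*} [CommRing S] {ρ : S} (B : Module.Basis (Fin 2) ℤ S)
    (h0 : B 0 = 1) (h1 : B 1 = ρ) (hρ : ρ ^ 2 - ρ + 14 = 0) {w : S} (hw : 2 ∣ w ^ 5) :
    2 ∣ w := by
  have hsq : ∀ v : S, 2 ∣ v ^ 2 - v := by
    intro v
    obtain ⟨a, b, rfl⟩ := exists_eq_add_mul B h0 h1 v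
    obtain ⟨c, hc⟩ := (Int.even_mul_pred_self a).two_dvd
    obtain ⟨d, hd⟩ := (Int.even_mul_pred_self b).two_dvd
    have hc' : (a : S) * (a - 1) = 2 * c := by exact_mod_cast congrArg (Int.cast : ℤ → S) hc
    have hd' : (b : S) * (b - 1) = 2 * d := by exact_mod_cast congrArg (Int.cast : ℤ → S) hd
    exact ⟨c + d * ρ + a * b * ρ - 7 * b ^ 2, by
      linear_combination hc' + ρ * hd' + (b : S) ^ 2 * hρ⟩
  have h := (hsq w).mul_left (w ^ 3 + w ^ 2 + w + 1)
  have e : w = w ^ 5 - (w ^ 3 + w ^ 2 + w + 1) * (w ^ 2 - w) := by ring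
  rw [e]
  exact dvd_sub hw h

theorem isPrincipal_of_isPrincipal_pow_five_of_absNorm_le {K : Type*} [Field K] [NumberField K]
    {ρ : 𝓞 K} (B : Module.Basis (Fin 2) ℤ (𝓞 K)) (h0 : B 0 = 1) (h1 : B 1 = ρ)
    (hρ : ρ ^ 2 - ρ + 14 = 0) {I : Ideal (𝓞 K)} (hI0 : I ≠ ⊥) (hI : I.absNorm ≤ 4)
    (h5 : (I ^ 5).IsPrincipal) : I.IsPrincipal := by
  obtain ⟨⟨γ, hγ⟩⟩ := h5
  rw [Ideal.submodule_span_eq] at hγ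
  obtain ⟨a, b, rfl⟩ := exists_eq_add_mul B h0 h1 γ
  have hN := congrArg Ideal.absNorm hγ
  rw [map_pow, Ideal.absNorm_span_singleton, norm_int_add_mul B h0 h1 hρ] at hN
  have hN' : a ^ 2 + a * b + 14 * b ^ 2 = (I.absNorm : ℤ) ^ 5 := by
    rw [← Nat.cast_pow, hN, Int.natAbs_of_nonneg]
    nlinarith [sq_nonneg (2 * a + b), sq_nonneg b]
  rcases norm_form_eq_pow_five hI (by simpa [Ideal.absNorm_eq_zero_iff] using hI0) hN' with
    h | ⟨h, ⟨c, rfl⟩, ⟨d, rfl⟩⟩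
  · rw [Ideal.absNorm_eq_one_iff.mp h]
    exact top_isPrincipal
  · have hle : I ≤ Ideal.span {2} := fun w hw => by
      refine Ideal.mem_span_singleton.mpr (two_dvd_of_two_dvd_pow_five B h0 h1 hρ ?_)
      have := Ideal.pow_mem_pow hw 5
      rw [hγ, Ideal.mem_span_singleton] at this
      exact dvd_trans ⟨c + d * ρ, by push_cast; ring⟩ this
    obtain ⟨J, rfl⟩ := Ideal.dvd_iff_le.mpr hle
    have h2 : Algebra.norm ℤ (2 : 𝓞 K) = 4 := by
      simpa using norm_int_add_mul B h0 h1 hρ 2 0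
    rw [map_mul, Ideal.absNorm_span_singleton, h2] at h
    have hJ : J.absNorm = 1 := by simpa using h
    rw [Ideal.absNorm_eq_one_iff.mp hJ, Ideal.mul_top]
    exact ⟨⟨2, rfl⟩⟩

open scoped nonZeroDivisors Real in
theorem exists_mk0_eq_absNorm_le_four {K : Type*} [Field K] [NumberField K]
    (hK : Module.finrank ℚ K = 2) (hd : discr K = -55) (C : ClassGroup (𝓞 K)) :
    ∃ I : (Ideal (𝓞 K))⁰, ClassGroup.mk0 I = C ∧ Ideal.absNorm (I : Ideal (𝓞 K)) ≤ 4 := by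
  obtain ⟨I, hI, hle⟩ := exists_ideal_in_class_of_norm_le C
  refine ⟨I, hI, ?_⟩
  have hr : InfinitePlace.nrComplexPlaces K ≤ 1 := by
    have := InfinitePlace.card_add_two_mul_card_eq_rank K
    omega
  have hπ : 1 ≤ 4 / π := by
    rw [one_le_div Real.pi_pos]; exact Real.pi_le_four
  have hπ3 : 4 / π ≤ 4 / 3.14 := by
    gcongr; exact Real.pi_gt_d2.le
  have hp : (4 / π) ^ InfinitePlace.nrComplexPlaces K ≤ 4 / 3.14 :=
    (pow_le_pow_right₀ hπ hr).trans (by rwa [pow_one])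
  have hs : √(55 : ℝ) ≤ 7.5 := by
    rw [Real.sqrt_le_left (by norm_num)]; norm_num
  have hlt : (Ideal.absNorm (I : Ideal (𝓞 K)) : ℝ) < 5 := by
    refine hle.trans_lt ?_
    rw [hK, hd]
    norm_num [Nat.factorial]
    calc _ ≤ (4 / 3.14 : ℝ) * (1 / 2 * 7.5) := by gcongr
      _ < 5 := by norm_num
  have : Ideal.absNorm (I : Ideal (𝓞 K)) < 5 := by exact_mod_cast hlt
  omega

theorem mk0_pow_eq_one_iff {R : Type*} [CommRing R] [IsDedekindDomain R] {I : Ideal R}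
    (hI : I ∈ nonZeroDivisors (Ideal R)) {n : ℕ} :
    ClassGroup.mk0 ⟨I, hI⟩ ^ n = 1 ↔ (I ^ n).IsPrincipal := by
  rw [← map_pow, SubmonoidClass.mk_pow, ClassGroup.mk0_eq_one_iff]

theorem isPrincipal_of_isPrincipal_pow_five {K : Type*} [Field K] [NumberField K]
    (hK : Module.finrank ℚ K = 2)
    {ρ : 𝓞 K} (B : Module.Basis (Fin 2) ℤ (𝓞 K)) (h0 : B 0 = 1) (h1 : B 1 = ρ)
    (hρ : ρ ^ 2 - ρ + 14 = 0) {Q : Ideal (𝓞 K)} (hQ : Q ≠ ⊥)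
    (h5 : (Q ^ 5).IsPrincipal) : Q.IsPrincipal := by
  have hd : discr K = -55 := by
    rw [← discr_eq_discr K B, discr_eq_neg_fiftyFive B h0 h1 hρ]
  have hQ0 : Q ∈ nonZeroDivisors (Ideal (𝓞 K)) := mem_nonZeroDivisors_of_ne_zero hQ
  obtain ⟨⟨I, hI0⟩, hI, hle⟩ := exists_mk0_eq_absNorm_le_four hK hd (ClassGroup.mk0 ⟨Q, hQ0⟩)
  rw [← mk0_pow_eq_one_iff hQ0, ← hI, mk0_pow_eq_one_iff] at h5
  have hIp := isPrincipal_of_isPrincipal_pow_five_of_absNorm_le B h0 h1 hρ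
    (nonZeroDivisors.ne_zero hI0) hle h5
  rwa [← ClassGroup.mk0_eq_one_iff hQ0, ← hI, ClassGroup.mk0_eq_one_iff]

theorem span_two_mul_span_two {S : Type*} [CommRing S] {ρ : S} (hρ : ρ ^ 2 - ρ + 14 = 0) :
    Ideal.span {2, ρ} * Ideal.span {2, 1 - ρ} = Ideal.span {(2 : S)} := by
  apply le_antisymm
  · rw [Ideal.span_pair_mul_span_pair, Ideal.span_le]
    simp only [Set.insert_subset_iff, Set.singleton_subset_iff, SetLike.mem_coe,
      Ideal.mem_span_singleton]
    exact ⟨⟨2, rfl⟩, ⟨1 - ρ, rfl⟩, ⟨ρ, by ring⟩, ⟨7, by linear_combination -hρ⟩⟩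
  · rw [Ideal.span_singleton_le_iff_mem]
    have hl : ∀ a b : S, a ∈ Ideal.span {a, b} := fun a b => Ideal.subset_span (by simp)
    have hr : ∀ a b : S, b ∈ Ideal.span {a, b} := fun a b => Ideal.subset_span (by simp)
    have h := add_mem (Ideal.mul_mem_mul (hl 2 ρ) (hr 2 (1 - ρ)))
      (Ideal.mul_mem_mul (hr 2 ρ) (hl 2 (1 - ρ)))
    rwa [show 2 * (1 - ρ) + ρ * 2 = 2 by ring] at h

theorem span_two_pow_four {S : Type*} [CommRing S] {ρ : S} (hρ : ρ ^ 2 - ρ + 14 = 0) :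
    Ideal.span {2, ρ} ^ 4 = Ideal.span {(2 : S) - ρ} := by
  have hsq : Ideal.span {2, ρ} ^ 2 = Ideal.span {(4 : S), 2 - ρ} := by
    have h2 : (4 : S) ∈ Ideal.span {2, ρ} ^ 2 := by
      rw [← show (2 : S) ^ 2 = 4 by norm_num]
      exact Ideal.pow_mem_pow (Ideal.subset_span (by simp)) 2
    apply le_antisymm
    · rw [pow_two, Ideal.span_pair_mul_span_pair, Ideal.span_le]
      simp only [Set.insert_subset_iff, Set.singleton_subset_iff, SetLike.mem_coe,
        Ideal.mem_span_pair]
      exact ⟨⟨1, 0, by ring⟩, ⟨1, -2, by ring⟩, ⟨1, -2, by ring⟩,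
        ⟨-3, -1, by linear_combination -hρ⟩⟩
    · rw [Ideal.span_le, Set.insert_subset_iff, Set.singleton_subset_iff]
      refine ⟨h2, ?_⟩
      rw [SetLike.mem_coe, show 2 - ρ = -3 * 4 - ρ ^ 2 by linear_combination hρ]
      exact sub_mem (Ideal.mul_mem_left _ _ h2) (Ideal.pow_mem_pow (Ideal.subset_span (by simp)) 2)
  rw [show 4 = 2 * 2 from rfl, pow_mul, hsq, pow_two, Ideal.span_pair_mul_span_pair]
  apply le_antisymm
  · rw [Ideal.span_le]
    simp only [Set.insert_subset_iff, Set.singleton_subset_iff, SetLike.mem_coe,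
      Ideal.mem_span_singleton]
    exact ⟨⟨1 + ρ, by linear_combination hρ⟩, ⟨4, by ring⟩, ⟨4, by ring⟩, ⟨2 - ρ, rfl⟩⟩
  · rw [Ideal.span_singleton_le_iff_mem]
    have hmem : ∀ {w : S}, w ∈ ({4 * 4, 4 * (2 - ρ), (2 - ρ) * 4, (2 - ρ) * (2 - ρ)} : Set S) →
        w ∈ Ideal.span {4 * 4, 4 * (2 - ρ), (2 - ρ) * 4, (2 - ρ) * (2 - ρ)} :=
      fun hw => Ideal.subset_span hw
    have h := sub_mem (sub_mem (hmem (w := 4 * (2 - ρ)) (by simp))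
      (hmem (w := (2 - ρ) * (2 - ρ)) (by simp))) (hmem (w := 4 * 4) (by simp))
    rwa [show 4 * (2 - ρ) - (2 - ρ) * (2 - ρ) - 4 * 4 = 2 - ρ by linear_combination -hρ] at h

theorem exists_eq_pow_of_mul_eq_mul_pow {R : Type*} [CommRing R] [IsDedekindDomain R]
    {P P' I I' C : Ideal R} {m n : ℕ} (hII : IsCoprime I I') (hIP : P ∣ I)
    (hIP' : P' ∣ I') (hP : P * P' ≠ ⊥) (h : I * I' = (P * P') ^ m * C ^ n) :
    ∃ J : Ideal R, I = P ^ m * J ^ n := by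
  have hd : P ^ m ∣ I := by
    refine IsCoprime.dvd_of_dvd_mul_right (z := I') ?_ ?_
    · exact (hII.of_isCoprime_of_dvd_left hIP).pow_left
    · exact ⟨P' ^ m * C ^ n, by rw [h]; ring⟩
  have hd' : P' ^ m ∣ I' := by
    refine IsCoprime.dvd_of_dvd_mul_left (y := I) ?_ ?_
    · exact (hII.symm.of_isCoprime_of_dvd_left hIP').pow_left
    · exact ⟨P ^ m * C ^ n, by rw [h]; ring⟩
  obtain ⟨A, rfl⟩ := hd
  obtain ⟨A', rfl⟩ := hd'
  have hAA : A * A' = C ^ n := by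
    refine mul_left_cancel₀ (pow_ne_zero m hP) ?_
    rw [← h]; ring
  classical
  let _ : GCDMonoid (Ideal R) := UniqueFactorizationMonoid.toGCDMonoid _
  obtain ⟨J, rfl⟩ := exists_eq_pow_of_mul_eq_pow_of_coprime
    hII.of_mul_left_right.of_mul_right_right hAA
  exact ⟨J, rfl⟩

theorem descent_to_element_equation (K : Type*) [Field K] [NumberField K]
    (hK : Module.finrank ℚ K = 2) (ρ : 𝓞 K) (hρ : ρ ^ 2 - ρ + 14 = 0)
    (x z y1 : ℤ) (hx : 0 < x) (hz : 0 < z) (hy1 : 0 < y1)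
    (heq : x ^ 2 + 55 * z ^ 2 = 2 ^ 5 * y1 ^ 5)
    (hgcd : IsCoprime x (55 * z))
    (hx4 : x % 4 = 1) (hxz4 : (x - z) % 4 = 0) :
    ∃ u v : ℤ, (1 + ρ) * ((x : 𝓞 K) - (z : 𝓞 K) + 2 * (z : 𝓞 K) * ρ) =
      (2 - ρ) * ((u : 𝓞 K) + (v : 𝓞 K) * ρ) ^ 5 := by
  obtain ⟨B, h0, h1⟩ := exists_int_basis hK hρ
  obtain ⟨m, hm⟩ : ∃ m, x - z = 4 * m := ⟨(x - z) / 4, by omega⟩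
  obtain rfl : x = z + 4 * m := by omega
  set α : 𝓞 K := 2 * m + z * ρ with hα
  set α' : 𝓞 K := 2 * m + z * (1 - ρ) with hα'
  have hnorm : α * α' = 8 * (y1 : 𝓞 K) ^ 5 := by
    have h4 : (2 * m) ^ 2 + 2 * m * z + 14 * z ^ 2 = 8 * y1 ^ 5 := by linarith
    have h4' : (2 * m : 𝓞 K) ^ 2 + 2 * m * z + 14 * z ^ 2 = 8 * y1 ^ 5 := by exact_mod_cast h4
    rw [hα, hα']
    linear_combination h4' - (z : 𝓞 K) ^ 2 * hρ
  have hcop : IsCoprime (z + 4 * m) (8 * y1 ^ 5) := by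
    have h := (hgcd.mul_right hgcd.of_mul_right_right).add_mul_left_right (z + 4 * m)
    rw [show 55 * z * z + (z + 4 * m) * (z + 4 * m) = 4 * (8 * y1 ^ 5) by linarith] at h
    exact h.of_mul_right_right
  have hαα' : IsCoprime α α' := by
    have h : IsCoprime (α + α') (α * α') := by
      rw [hnorm]
      have := hcop.map (Int.castRingHom (𝓞 K))
      convert this using 1
      · simp [hα, hα']; ring
      · simp
    refine IsCoprime.of_add_mul_left_right (z := 1) ?_
    rw [mul_one, add_comm]
    exact h.of_mul_right_left.symm
  have hρ' : (1 - ρ) ^ 2 - (1 - ρ) + 14 = 0 := by linear_combination hρ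
  have hPP := span_two_mul_span_two hρ
  have hP4 := span_two_pow_four hρ
  have hP4' := span_two_pow_four hρ'
  rw [show 2 - (1 - ρ) = 1 + ρ by ring] at hP4'
  have hαP : Ideal.span {2, ρ} ∣ Ideal.span {α} := by
    rw [Ideal.dvd_span_singleton, Ideal.mem_span_pair]
    exact ⟨m, z, by rw [hα]; ring⟩
  have hαP' : Ideal.span {2, 1 - ρ} ∣ Ideal.span {α'} := by
    rw [Ideal.dvd_span_singleton, Ideal.mem_span_pair]
    exact ⟨m, z, by rw [hα']; ring⟩
  generalize Ideal.span {2, ρ} = P at hPP hP4 hαP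
  generalize Ideal.span {2, 1 - ρ} = P' at hPP hP4' hαP'
  obtain ⟨J, hJ⟩ := exists_eq_pow_of_mul_eq_mul_pow (C := Ideal.span {(y1 : 𝓞 K)})
    (m := 3) (n := 5)
    ((Ideal.isCoprime_span_singleton_iff α α').mpr hαα') hαP hαP'
    (by rw [hPP]; simp) (by
      rw [hPP, Ideal.span_singleton_mul_span_singleton, hnorm, Ideal.span_singleton_pow,
        Ideal.span_singleton_pow, Ideal.span_singleton_mul_span_singleton]
      norm_num)
  have hQ : Ideal.span {2 - ρ} * (P' * J) ^ 5 = Ideal.span {(1 + ρ) * (2 * α)} := by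
    rw [← Ideal.span_singleton_mul_span_singleton, ← Ideal.span_singleton_mul_span_singleton,
      hJ, ← hP4, ← hP4', ← hPP]
    ring
  obtain ⟨δ, hδ⟩ : 2 - ρ ∣ (1 + ρ) * (2 * α) := by
    rw [← Ideal.mem_span_singleton, ← Ideal.dvd_span_singleton, ← hQ]
    exact dvd_mul_right _ _
  have hα0 : (1 + ρ) * (2 * α) ≠ 0 := by
    have hα : α * α' ≠ 0 := by
      rw [hnorm]
      exact mul_ne_zero (by norm_num) (pow_ne_zero 5 (Int.cast_ne_zero.mpr hy1.ne'))
    have hπ : (1 + ρ) * (2 - ρ) ≠ 0 := by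
      rw [show (1 + ρ) * (2 - ρ) = 16 by linear_combination -hρ]
      norm_num
    exact mul_ne_zero (left_ne_zero_of_mul hπ)
      (mul_ne_zero two_ne_zero (left_ne_zero_of_mul hα))
  rw [hδ] at hα0
  have hQ5 : (P' * J) ^ 5 = Ideal.span {δ} := by
    rw [hδ, ← Ideal.span_singleton_mul_span_singleton] at hQ
    refine mul_left_cancel₀ ?_ hQ
    simpa using left_ne_zero_of_mul hα0
  have hQ0 : P' * J ≠ ⊥ := by
    intro h
    rw [h, Ideal.bot_pow (by norm_num), eq_comm, Ideal.span_singleton_eq_bot] at hQ5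
    exact right_ne_zero_of_mul hα0 hQ5
  obtain ⟨⟨β, hβ⟩⟩ := isPrincipal_of_isPrincipal_pow_five hK B h0 h1 hρ hQ0
    (by rw [hQ5]; exact ⟨⟨δ, rfl⟩⟩)
  rw [hβ, Ideal.submodule_span_eq, Ideal.span_singleton_pow,
    Ideal.span_singleton_eq_span_singleton] at hQ5
  obtain ⟨ε, hε⟩ := hQ5
  obtain ⟨γ, hγ⟩ : ∃ γ, δ = γ ^ 5 := by
    rcases eq_one_or_eq_neg_one_of_isUnit B h0 h1 hρ ε.isUnit with h | h
    · exact ⟨β, by rw [← hε, h, mul_one]⟩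
    · exact ⟨-β, by rw [← hε, h]; ring⟩
  obtain ⟨u, v, rfl⟩ := exists_eq_add_mul B h0 h1 γ
  refine ⟨u, v, ?_⟩
  rw [← hγ, ← hδ, hα]
  push_cast
  ring
end
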